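/- Let m, n be nonnegative integers and let 1 ≤ x_1 < x_2 < ⋯ < x_n ≤ m+n be integers. Let T_{m,n}(x_1,…,x_n) be the region obtained from the trapezoid on the triangular lattice with side lengths m, n, m+n, n (clockwise from the bottom side) by removing the down-pointing unit triangles along its top side that are in positions x_1, x_2, …, x_n counted from left to right. Then M(T_{m,n}(x_1,…,x_n)) = ∏_{1 ≤ i < j ≤ n} (x_j − x_i)/(j − i). -/

import Mathlib

/-- A unit triangle of the triangular lattice, encoded as `(x, y, ε)` where
`ε = true` means up-pointing and `ε = false` means down-pointing. -/
abbrev Tri : Type := ℤ × ℤ × Bool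

/-- Two unit triangles are adjacent (i.e. together they form a lozenge) iff one of them is
the up-triangle at `(x,y)` and the other is one of the down-triangles at
`(x,y)`, `(x-1,y)`, `(x,y-1)`. -/
def Adj (s t : Tri) : Prop :=
  ∃ x y : ℤ,
    ({s, t} : Set Tri) = {(x, y, true), (x, y, false)} ∨
    ({s, t} : Set Tri) = {(x, y, true), (x - 1, y, false)} ∨
    ({s, t} : Set Tri) = {(x, y, true), (x, y - 1, false)}

/-- `P` is a lozenge tiling of the region `R`: a partition of `R` into pairs of
adjacent unit triangles. -/
def IsLozengeTiling (R : Set Tri) (P : Set (Set Tri)) : Prop :=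
  (∀ L ∈ P, ∃ s t : Tri, Adj s t ∧ L = {s, t}) ∧
  (∀ L ∈ P, L ⊆ R) ∧
  (∀ r ∈ R, ∃! L, L ∈ P ∧ r ∈ L)

/-- The number of lozenge tilings of the region `R`. -/
noncomputable def M (R : Set Tri) : ℕ :=
  Nat.card {P : Set (Set Tri) // IsLozengeTiling R P}

/-- The hexagonal region `H^k_{a,b,c}` on the triangular lattice, whose side lengths in
clockwise order starting from the top side are `a, b+k, c, a+k, b, c+k`.
(Concretely: the unit triangles all of whose vertices `(x,y)` satisfy
`0 ≤ x ≤ a+b+k`, `0 ≤ y ≤ b+c+k`, `b ≤ x+y ≤ a+b+c+k`.) -/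
def HexK (a b c k : ℕ) : Set Tri :=
  {t | 0 ≤ t.1 ∧ t.1 ≤ (a : ℤ) + b + k - 1 ∧ 0 ≤ t.2.1 ∧ t.2.1 ≤ (b : ℤ) + c + k - 1 ∧
    (if t.2.2 then (b : ℤ) ≤ t.1 + t.2.1 ∧ t.1 + t.2.1 ≤ (a : ℤ) + b + c + k - 1
     else (b : ℤ) - 1 ≤ t.1 + t.2.1 ∧ t.1 + t.2.1 ≤ (a : ℤ) + b + c + k - 2)}

/-- The hexagonal region `H_{a,b,c}` whose side lengths in clockwise order starting from
the top side are `a, b, c, a, b, c`. -/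
def Hex (a b c : ℕ) : Set Tri := HexK a b c 0

/-- The trapezoidal region with side lengths `m, n, m+n, n` (clockwise from the bottom side).
(Concretely: the unit triangles all of whose vertices `(x,y)` satisfy
`0 ≤ y ≤ n`, `0 ≤ x + y`, `x ≤ m`.) -/
def Trap (m n : ℕ) : Set Tri :=
  {t | t.1 ≤ (m : ℤ) - 1 ∧ 0 ≤ t.2.1 ∧ t.2.1 ≤ (n : ℤ) - 1 ∧
    (if t.2.2 then 0 ≤ t.1 + t.2.1 else -1 ≤ t.1 + t.2.1)}


/-- The positions of the lozenges of the three orientations containing a given unit triangle: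
the lozenge of orientation `k` containing `t` has its up-triangle at `lozengeBase k t`. -/
def lozengeBase (k : Fin 3) (t : Tri) : ℤ × ℤ :=
  if t.2.2 then (t.1, t.2.1)
  else (t.1 + if k = 1 then 1 else 0, t.2.1 + if k = 2 then 1 else 0)

/-- The lozenge of orientation `k` whose up-triangle is at `p`. -/
def lozenge (k : Fin 3) (p : ℤ × ℤ) : Set Tri :=
  {(p.1, p.2, true), (p.1 - (if k = 1 then 1 else 0), p.2 - (if k = 2 then 1 else 0), false)}

theorem mem_lozenge {k : Fin 3} {p : ℤ × ℤ} {t : Tri} :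
    t ∈ lozenge k p ↔ p = lozengeBase k t := by
  obtain ⟨x, y, e⟩ := t
  obtain ⟨u, v⟩ := p
  cases e <;> simp [lozenge, lozengeBase] <;> grind

theorem lozenge_inj {j k : Fin 3} {p q : ℤ × ℤ} (h : lozenge j p = lozenge k q) : j = k := by
  obtain ⟨u, v⟩ := p
  obtain ⟨u', v'⟩ := q
  have h1 : ((u, v, true) : Tri) ∈ lozenge k (u', v') := h ▸ by simp [lozenge]
  have h2 : ((u - (if j = 1 then 1 else 0), v - (if j = 2 then 1 else 0), false) : Tri) ∈
      lozenge k (u', v') := h ▸ by simp [lozenge]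
  rw [mem_lozenge] at h1 h2
  simp [lozengeBase] at h1 h2
  obtain ⟨rfl, rfl⟩ := h1
  fin_cases j <;> fin_cases k <;> simp at h2 ⊢ <;> omega

theorem exists_lozenge_of_adj {s t : Tri} (h : Adj s t) :
    ∃ k p, ({s, t} : Set Tri) = lozenge k p := by
  obtain ⟨x, y, h | h | h⟩ := h
  · exact ⟨0, (x, y), by simp [h, lozenge]⟩
  · exact ⟨1, (x, y), by simp [h, lozenge]⟩
  · exact ⟨2, (x, y), by simp [h, lozenge]⟩

theorem exists_adj_lozenge (k : Fin 3) (p : ℤ × ℤ) :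
    ∃ s t : Tri, Adj s t ∧ lozenge k p = {s, t} := by
  refine ⟨_, _, ⟨p.1, p.2, ?_⟩, rfl⟩
  fin_cases k <;> simp

open Classical in
/-- `f` is the indicator function of (the set of lozenges of) a tiling of `R`: every triangle
is covered with total weight one or zero, according to whether it lies in `R`. -/
def IsTilingWeight (R : Set Tri) (f : Fin 3 → ℤ × ℤ → ℕ) : Prop :=
  ∀ t, ∑ k, f k (lozengeBase k t) = if t ∈ R then 1 else 0

open Classical in
theorem IsLozengeTiling.isTilingWeight {R : Set Tri} {P : Set (Set Tri)}
    (hP : IsLozengeTiling R P) :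
    IsTilingWeight R fun k p => if lozenge k p ∈ P then 1 else 0 := by
  obtain ⟨hadj, hsub, hcov⟩ := hP
  intro t
  by_cases ht : t ∈ R
  · obtain ⟨L, ⟨hL, htL⟩, huniq⟩ := hcov t ht
    obtain ⟨a, b, hab, rfl⟩ := hadj L hL
    obtain ⟨k, p, hk⟩ := exists_lozenge_of_adj hab
    rw [hk] at hL htL huniq
    obtain rfl := mem_lozenge.1 htL
    rw [if_pos ht, Finset.sum_eq_single k]
    · exact if_pos hL
    · intro j _ hj
      exact if_neg fun h => hj (lozenge_inj (huniq _ ⟨h, mem_lozenge.2 rfl⟩))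
    · simp
  · rw [if_neg ht]
    exact Finset.sum_eq_zero fun k _ => if_neg fun h => ht (hsub _ h (mem_lozenge.2 rfl))

theorem IsTilingWeight.le_one {R : Set Tri} {f : Fin 3 → ℤ × ℤ → ℕ}
    (hf : IsTilingWeight R f) (k : Fin 3) (p : ℤ × ℤ) : f k p ≤ 1 := by
  have h := hf (p.1, p.2, true)
  have h1 := Finset.single_le_sum (f := fun k => f k (lozengeBase k (p.1, p.2, true)))
    (fun _ _ => Nat.zero_le _) (Finset.mem_univ k)
  refine h1.trans (h.le.trans ?_)
  split_ifs <;> simp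

theorem IsTilingWeight.isLozengeTiling {R : Set Tri} {f : Fin 3 → ℤ × ℤ → ℕ}
    (hf : IsTilingWeight R f) :
    IsLozengeTiling R {L | ∃ k p, f k p ≠ 0 ∧ L = lozenge k p} := by
  classical
  refine ⟨?_, ?_, ?_⟩
  · rintro _ ⟨k, p, -, rfl⟩
    exact exists_adj_lozenge k p
  · rintro _ ⟨k, p, hk, rfl⟩ t ht
    obtain rfl := mem_lozenge.1 ht
    by_contra hR
    have h := hf t
    rw [if_neg hR, Finset.sum_eq_zero_iff] at h
    exact hk (h k (Finset.mem_univ k))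
  · intro t ht
    have h := hf t
    rw [if_pos ht] at h
    obtain ⟨k, -, hk⟩ := Finset.exists_ne_zero_of_sum_ne_zero (h.trans_ne one_ne_zero)
    refine ⟨lozenge k (lozengeBase k t), ⟨⟨k, _, hk, rfl⟩, mem_lozenge.2 rfl⟩, ?_⟩
    rintro _ ⟨⟨j, p, hj, rfl⟩, htj⟩
    obtain rfl := mem_lozenge.1 htj
    by_cases hjk : j = k
    · rw [hjk]
    · have h2 := Finset.sum_le_sum_of_subset (f := fun k => f k (lozengeBase k t))
        (Finset.subset_univ {j, k})
      rw [Finset.sum_pair hjk, h] at h2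
      omega

theorem M_eq_card_isTilingWeight (R : Set Tri) : M R = Nat.card {f // IsTilingWeight R f} := by
  classical
  refine Nat.card_congr
    { toFun := fun P => ⟨_, P.2.isTilingWeight⟩
      invFun := fun f => ⟨_, f.2.isLozengeTiling⟩
      left_inv := ?_
      right_inv := ?_ }
  · rintro ⟨P, hP⟩
    ext L
    simp only [ne_eq, ite_eq_right_iff, one_ne_zero, imp_false, not_not, Set.mem_ofPred_eq]
    constructor
    · rintro ⟨k, p, h, rfl⟩
      exact h
    · intro hL
      obtain ⟨a, b, hab, rfl⟩ := hP.1 L hL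
      obtain ⟨k, p, hk⟩ := exists_lozenge_of_adj hab
      exact ⟨k, p, hk ▸ hL, hk⟩
  · rintro ⟨f, hf⟩
    ext k p
    have h1 := hf.le_one k p
    have h2 : lozenge k p ∈ {L | ∃ k p, f k p ≠ 0 ∧ L = lozenge k p} ↔ f k p ≠ 0 := by
      constructor
      · rintro ⟨j, q, hj, h⟩
        have hq : ((p.1, p.2, true) : Tri) ∈ lozenge j q := h ▸ mem_lozenge.2 rfl
        obtain rfl : q = p := mem_lozenge.1 hq
        rwa [lozenge_inj h]
      · exact fun h => ⟨k, p, h, rfl⟩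
    simp only [h2]
    split_ifs <;> omega

/-- The number of indices `i` with `a i = x`. -/
def occ {n : ℕ} (a : Fin n → ℤ) (x : ℤ) : ℕ := ∑ i, if x = a i then 1 else 0

theorem occ_apply {n : ℕ} {a : Fin n → ℤ} (ha : StrictMono a) (i : Fin n) : occ a (a i) = 1 := by
  simp [occ, ha.injective.eq_iff]

theorem occ_eq_zero {n : ℕ} {a : Fin n → ℤ} {x : ℤ} (h : ∀ i, x ≠ a i) : occ a x = 0 := by
  simp [occ, h]

theorem eq_of_occ_eq {n : ℕ} {a b : Fin n → ℤ} (ha : StrictMono a) (hb : StrictMono b)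
    (h : occ a = occ b) : a = b := by
  have key : ∀ {c d : Fin n → ℤ}, StrictMono c → occ c = occ d → Set.range c ⊆ Set.range d := by
    rintro c d hc h _ ⟨i, rfl⟩
    by_contra hi
    have := occ_apply hc i
    rw [h, occ_eq_zero fun j hj => hi ⟨j, hj.symm⟩] at this
    omega
  exact (ha.range_inj hb).1 ((key ha h).antisymm (key hb h.symm))

/-- The trapezoid with dents in its top row at the down-triangles with abscissas `a i`. -/
abbrev dentedTrap (m : ℕ) {n : ℕ} (a : Fin n → ℤ) : Set Tri :=
  Trap m n \ {t | ∃ i : Fin n, t = (a i, (n : ℤ) - 1, false)}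

theorem isTilingWeight_dentedTrap {m n : ℕ} {a : Fin n → ℤ} (ha : StrictMono a)
    (h1 : ∀ i, -(n : ℤ) ≤ a i) (h2 : ∀ i, a i < m) {f : Fin 3 → ℤ × ℤ → ℕ} :
    IsTilingWeight (dentedTrap m a) f ↔ ∀ x y,
      f 0 (x, y) + f 1 (x, y) + f 2 (x, y) =
        (if 0 ≤ y ∧ y < n ∧ -y ≤ x ∧ x < m then 1 else 0) ∧
      f 0 (x, y) + f 1 (x + 1, y) + f 2 (x, y + 1) + (if y = (n : ℤ) - 1 then occ a x else 0) =
        if 0 ≤ y ∧ y < n ∧ -1 - y ≤ x ∧ x < m then 1 else 0 := by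
  classical
  simp only [IsTilingWeight, Prod.forall, Bool.forall_bool]
  refine forall_congr' fun x => forall_congr' fun y => ?_
  rw [and_comm]
  refine and_congr ?_ ?_
  · have : ((x, y, true) ∈ dentedTrap m a) ↔ 0 ≤ y ∧ y < n ∧ -y ≤ x ∧ x < m := by
      simp [dentedTrap, Trap]; omega
    simp [this, Fin.sum_univ_three, lozengeBase]
  · have : ((x, y, false) ∈ dentedTrap m a) ↔
        (0 ≤ y ∧ y < n ∧ -1 - y ≤ x ∧ x < m) ∧ ¬ (y = (n : ℤ) - 1 ∧ ∃ i, x = a i) := by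
      simp only [dentedTrap, Trap, Set.mem_sdiff, Set.mem_ofPred_eq, Prod.mk.injEq]
      grind
    have hsum : ∑ k, f k (lozengeBase k (x, y, false)) =
        f 0 (x, y) + f 1 (x + 1, y) + f 2 (x, y + 1) := by
      simp [Fin.sum_univ_three, lozengeBase]
    rw [hsum]
    simp only [this]
    by_cases hd : y = (n : ℤ) - 1 ∧ ∃ i, x = a i
    · obtain ⟨rfl, i, rfl⟩ := hd
      have := i.pos
      have := h1 i
      have := h2 i
      rw [if_neg fun h => h.2 ⟨rfl, i, rfl⟩, if_pos rfl, if_pos (by omega), occ_apply ha]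
      omega
    · have h0 : (if y = (n : ℤ) - 1 then occ a x else 0) = 0 := by
        split_ifs with hy
        · exact occ_eq_zero fun i hi => hd ⟨hy, i, hi⟩
        · rfl
      simp [hd, h0]

/-- The weights `r`, `l`, `v` of the lozenges of the three orientations whose up-triangle lies in
a given row describe a tiling of that row, consisting of the down-triangles from `lo` to `hi` and
the up-triangles between them, where the down-triangles `a i` are dents. -/
def IsRowTiling (lo hi : ℤ) {n : ℕ} (a : Fin n → ℤ) (r l v : ℤ → ℕ) : Prop :=
  ∀ x, r x + l x + v x = (if lo < x ∧ x ≤ hi then 1 else 0) ∧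
    r x + l (x + 1) + occ a x = if lo ≤ x ∧ x ≤ hi then 1 else 0

theorem IsRowTiling.ext {lo hi : ℤ} {n : ℕ} {a : Fin n → ℤ} {r l r' l' v : ℤ → ℕ}
    (h : IsRowTiling lo hi a r l v) (h' : IsRowTiling lo hi a r' l' v) : r = r' ∧ l = l' := by
  have hstep : ∀ x, r (x + 1) + r' x = r' (x + 1) + r x := fun x => by
    have := h x; have := h' x; have := (h (x + 1)).1; have := (h' (x + 1)).1; omega
  have hneg : ∀ x ≤ lo, r x = r' x := fun x hx => by
    have := (h x).1; have := (h' x).1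
    rw [if_neg (by omega)] at *
    omega
  have hr : ∀ x, r x = r' x := fun x => by
    obtain hx | hx := le_total x lo
    · exact hneg x hx
    · induction x, hx using Int.leInduction with
      | base => exact hneg lo le_rfl
      | succ x _ ih => have := hstep x; omega
  refine ⟨funext hr, funext fun x => ?_⟩
  have := (h x).1; have := (h' x).1; have := hr x
  omega

theorem exists_mem_Ioc_of_mem_Ioc {n : ℕ} {a : Fin (n + 1) → ℤ} {x : ℤ} (h0 : a 0 < x)
    (h1 : x ≤ a (Fin.last n)) : ∃ i : Fin n, x ∈ Finset.Ioc (a i.castSucc) (a i.succ) := by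
  by_contra! h
  have : ∀ i, a i < x := fun i => by
    induction i using Fin.induction with
    | zero => exact h0
    | succ i ih => simpa [ih] using h i
  exact (this _).not_ge h1

theorem eq_of_mem_Ioc_of_mem_Ioc {n : ℕ} {a : Fin (n + 1) → ℤ} (ha : StrictMono a) {x : ℤ}
    {i j : Fin n} (hi : x ∈ Finset.Ioc (a i.castSucc) (a i.succ))
    (hj : x ∈ Finset.Ioc (a j.castSucc) (a j.succ)) : i = j := by
  rw [Finset.mem_Ioc] at hi hj
  have h1 := ha.lt_iff_lt.1 (hi.1.trans_le hj.2)
  have h2 := ha.lt_iff_lt.1 (hj.1.trans_le hi.2)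
  rw [Fin.castSucc_lt_succ_iff] at h1 h2
  exact h1.antisymm h2

theorem strictMono_of_interlacing {n : ℕ} {a : Fin (n + 1) → ℤ} (ha : StrictMono a)
    {y : Fin n → ℤ} (hy : ∀ i, y i ∈ Finset.Ioc (a i.castSucc) (a i.succ)) : StrictMono y :=
  fun i j hij => (Finset.mem_Ioc.1 (hy i)).2.trans_lt <|
    (ha.monotone (Fin.succ_le_castSucc_iff.2 hij)).trans_lt (Finset.mem_Ioc.1 (hy j)).1

theorem sum_Ioc_int_succ {β : Type*} [AddCommMonoid β] (f : ℤ → β) {p q : ℤ} (h : p ≤ q) :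
    ∑ x ∈ Finset.Ioc p (q + 1), f x = ∑ x ∈ Finset.Ioc p q, f x + f (q + 1) := by
  have : Finset.Ioc p (q + 1) = insert (q + 1) (Finset.Ioc p q) := by
    ext x
    simp only [Finset.mem_Ioc, Finset.mem_insert]
    omega
  rw [this, Finset.sum_insert (by simp), add_comm]

theorem IsRowTiling.sum_Ioc {lo hi : ℤ} {n : ℕ} {a : Fin n → ℤ} {r l v : ℤ → ℕ}
    (h : IsRowTiling lo hi a r l v) {p q : ℤ} (hp : lo ≤ p) (hpq : p ≤ q) (hq : q ≤ hi) :
    l (q + 1) + ∑ x ∈ Finset.Ioc p q, occ a x = l (p + 1) + ∑ x ∈ Finset.Ioc p q, v x := by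
  induction q, hpq using Int.leInduction with
  | base => simp
  | succ q hpq ih =>
    have h1 := h (q + 1)
    rw [if_pos (by omega), if_pos (by omega)] at h1
    have h2 := ih (by omega)
    rw [sum_Ioc_int_succ _ hpq, sum_Ioc_int_succ _ hpq]
    omega

theorem sum_Ioc_occ {n : ℕ} {a : Fin n → ℤ} (ha : StrictMono a) {p : ℤ} {i : Fin n}
    (hp : p < a i) (h : ∀ j < i, a j ≤ p) : ∑ x ∈ Finset.Ioc p (a i), occ a x = 1 := by
  rw [Finset.sum_eq_single (a i), occ_apply ha]
  · intro x hx hxi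
    rw [Finset.mem_Ioc] at hx
    refine occ_eq_zero ?_
    rintro j rfl
    obtain hj | rfl | hj := lt_trichotomy j i
    · exact (h j hj).not_gt hx.1
    · exact hxi rfl
    · exact (ha hj).not_ge hx.2
  · simp [hp]

theorem IsRowTiling.exists_interlacing {lo hi : ℤ} {n : ℕ} {a : Fin (n + 1) → ℤ}
    {r l v : ℤ → ℕ} (h : IsRowTiling lo hi a r l v) (ha : StrictMono a) (hlo : ∀ i, lo ≤ a i)
    (hhi : ∀ i, a i ≤ hi) :
    ∃ y : Fin n → ℤ, (∀ i, y i ∈ Finset.Ioc (a i.castSucc) (a i.succ)) ∧ v = occ y := by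
  have hl : ∀ i, l (a i + 1) = 0 := fun i => by
    have := (h (a i)).2
    rw [occ_apply ha, if_pos ⟨hlo i, hhi i⟩] at this
    omega
  have hleft : ∀ x ≤ a 0, v x = 0 := by
    intro x hx
    by_cases hxlo : lo < x
    · have h1 := h.sum_Ioc le_rfl (hlo 0) (hhi 0)
      rw [sum_Ioc_occ ha (by omega) (by simp), hl] at h1
      have h2 := (h lo).1
      have h3 := (h lo).2
      rw [if_neg (by omega)] at h2
      rw [if_pos ⟨le_rfl, (hlo 0).trans (hhi 0)⟩,
        occ_eq_zero fun i => (hxlo.trans_le (hx.trans (ha.monotone (Fin.zero_le i)))).ne] at h3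
      have h4 : ∑ x ∈ Finset.Ioc lo (a 0), v x = 0 := by omega
      exact Finset.sum_eq_zero_iff.1 h4 x (Finset.mem_Ioc.2 ⟨hxlo, hx⟩)
    · have := (h x).1
      rw [if_neg (by omega)] at this
      omega
  have hright : ∀ x, a (Fin.last n) < x → v x = 0 := by
    intro x hx
    by_cases hxhi : x ≤ hi
    · have h1 := h.sum_Ioc (hlo _) (hhi (Fin.last n)) le_rfl
      have h2 := (h (hi + 1)).1
      rw [if_neg (by omega)] at h2
      rw [hl, Finset.sum_eq_zero fun z hz => occ_eq_zero fun i =>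
        ((ha.monotone (Fin.le_last i)).trans_lt (Finset.mem_Ioc.1 hz).1).ne'] at h1
      have h4 : ∑ x ∈ Finset.Ioc (a (Fin.last n)) hi, v x = 0 := by omega
      exact Finset.sum_eq_zero_iff.1 h4 x (Finset.mem_Ioc.2 ⟨hx, hxhi⟩)
    · have := (h x).1
      rw [if_neg (by omega)] at this
      omega
  have hmid : ∀ i : Fin n, ∃ y ∈ Finset.Ioc (a i.castSucc) (a i.succ), v y = 1 ∧
      ∀ x ∈ Finset.Ioc (a i.castSucc) (a i.succ), x ≠ y → v x = 0 := by
    intro i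
    have hi : a i.castSucc < a i.succ := ha Fin.castSucc_lt_succ
    have h1 := h.sum_Ioc (hlo _) hi.le (hhi _)
    rw [hl, hl, sum_Ioc_occ ha hi fun j hj => ha.monotone (Fin.le_castSucc_iff.2 hj), zero_add,
      zero_add] at h1
    obtain ⟨y, hy, hvy⟩ := Finset.exists_ne_zero_of_sum_ne_zero (h1.symm.trans_ne one_ne_zero)
    have h2 := Finset.add_sum_erase _ v hy
    have h3 : ∑ x ∈ (Finset.Ioc (a i.castSucc) (a i.succ)).erase y, v x = 0 := by omega
    exact ⟨y, hy, by omega, fun x hx hxy =>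
      Finset.sum_eq_zero_iff.1 h3 x (Finset.mem_erase.2 ⟨hxy, hx⟩)⟩
  choose y hy hvy hvne using hmid
  have hys := strictMono_of_interlacing ha hy
  refine ⟨y, hy, funext fun x => ?_⟩
  by_cases hx : ∃ i, x = y i
  · obtain ⟨i, rfl⟩ := hx
    rw [hvy, occ_apply hys]
  · push Not at hx
    rw [occ_eq_zero hx]
    obtain h0 | h0 := le_or_gt x (a 0)
    · exact hleft x h0
    obtain h1 | h1 := lt_or_ge (a (Fin.last n)) x
    · exact hright x h1
    obtain ⟨i, hi⟩ := exists_mem_Ioc_of_mem_Ioc h0 h1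
    exact hvne i x hi (hx i)

theorem sum_ite_mem_Ioc {n : ℕ} {a : Fin (n + 1) → ℤ} (ha : Monotone a) (x : ℤ) :
    ∑ i : Fin n, (if a i.castSucc < x ∧ x ≤ a i.succ then 1 else 0) =
      if a 0 < x ∧ x ≤ a (Fin.last n) then 1 else 0 := by
  induction n with
  | zero => simp
  | succ n ih =>
    have h := ih (ha.comp Fin.strictMono_castSucc.monotone)
    have h0 : a 0 ≤ a (Fin.last n).castSucc := ha (Fin.zero_le _)
    have h1 : a (Fin.last n).castSucc ≤ a (Fin.last (n + 1)) := ha (Fin.le_last _)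
    simp only [Function.comp_apply, Fin.castSucc_zero] at h
    rw [Fin.sum_univ_castSucc]
    simp only [Fin.succ_castSucc, h, Fin.succ_last, Nat.succ_eq_add_one]
    grind

theorem exists_isRowTiling {lo hi : ℤ} {n : ℕ} {a : Fin (n + 1) → ℤ} (ha : StrictMono a)
    (hlo : ∀ i, lo ≤ a i) (hhi : ∀ i, a i ≤ hi) {y : Fin n → ℤ}
    (hy : ∀ i, y i ∈ Finset.Ioc (a i.castSucc) (a i.succ)) :
    ∃ r l, IsRowTiling lo hi a r l (occ y) := by
  refine ⟨fun x => ∑ i, (if a i.castSucc < x ∧ x < y i then 1 else 0) +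
      (if a (Fin.last n) < x ∧ x ≤ hi then 1 else 0),
    fun x => ∑ i, (if y i < x ∧ x ≤ a i.succ then 1 else 0) +
      (if lo < x ∧ x ≤ a 0 then 1 else 0), fun x => ?_⟩
  have h0 : a 0 ≤ a (Fin.last n) := ha.monotone (Fin.zero_le _)
  have h1 := hlo 0
  have h2 := hhi (Fin.last n)
  simp only [Finset.mem_Ioc] at hy
  beta_reduce
  constructor
  · have key := sum_ite_mem_Ioc ha.monotone x
    have : ∀ i, (if a i.castSucc < x ∧ x ≤ a i.succ then 1 else 0) =
        (if a i.castSucc < x ∧ x < y i then 1 else 0) +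
        (if y i < x ∧ x ≤ a i.succ then 1 else 0) + (if x = y i then 1 else 0) := fun i => by
      have := hy i
      split_ifs <;> omega
    simp only [this, Finset.sum_add_distrib] at key
    rw [occ]
    split_ifs at key ⊢ <;> omega
  · have key := sum_ite_mem_Ioc ha.monotone (x + 1)
    have : ∀ i, (if a i.castSucc < x + 1 ∧ x + 1 ≤ a i.succ then 1 else 0) =
        (if a i.castSucc < x ∧ x < y i then 1 else 0) +
        (if y i < x + 1 ∧ x + 1 ≤ a i.succ then 1 else 0) +
        (if x = a i.castSucc then 1 else 0) := fun i => by
      have := hy i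
      split_ifs <;> omega
    simp only [this, Finset.sum_add_distrib] at key
    rw [occ, Fin.sum_univ_castSucc]
    split_ifs at key ⊢ <;> omega

/-- The tilings of a dented trapezoid, encoded by their indicator functions. -/
abbrev DentedTrapTiling (m : ℕ) {n : ℕ} (a : Fin n → ℤ) : Type :=
  {f // IsTilingWeight (dentedTrap m a) f}

/-- Stack the row `(r, l, v)` on top of a tiling `f` of the rows below ordinate `t`. -/
def stack (t : ℤ) (f : Fin 3 → ℤ × ℤ → ℕ) (r l v : ℤ → ℕ) : Fin 3 → ℤ × ℤ → ℕ :=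
  fun k p => if p.2 = t then ![r, l, v] k p.1 else f k p

section Stack

variable {t : ℤ} {f : Fin 3 → ℤ × ℤ → ℕ} {r l v : ℤ → ℕ} {x : ℤ}

theorem stack_zero : stack t f r l v 0 (x, t) = r x := by simp [stack]

theorem stack_one : stack t f r l v 1 (x, t) = l x := by simp [stack]

theorem stack_two : stack t f r l v 2 (x, t) = v x := by simp [stack]

theorem stack_of_ne {s : ℤ} (h : s ≠ t) {k : Fin 3} : stack t f r l v k (x, s) = f k (x, s) := by
  simp [stack, h]

end Stack

section Recursion

variable {m n : ℕ} {a : Fin (n + 1) → ℤ} {f : Fin 3 → ℤ × ℤ → ℕ}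

theorem IsTilingWeight.isRowTiling (ha : StrictMono a) (h1 : ∀ i, -(n + 1 : ℤ) ≤ a i)
    (h2 : ∀ i, a i < m) (hf : IsTilingWeight (dentedTrap m a) f) :
    IsRowTiling (-(n + 1 : ℤ)) (m - 1) a (fun x => f 0 (x, n)) (fun x => f 1 (x, n))
      (fun x => f 2 (x, n)) := by
  rw [isTilingWeight_dentedTrap ha (by simpa using h1) h2] at hf
  push_cast at hf
  intro x
  have h := hf x n
  have h' := (hf x (n + 1)).1
  beta_reduce
  grind

theorem interlacing_bounds (h1 : ∀ i, -(n + 1 : ℤ) ≤ a i) (h2 : ∀ i, a i < m) {y : Fin n → ℤ}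
    (hy : ∀ i, y i ∈ Finset.Ioc (a i.castSucc) (a i.succ)) (i : Fin n) :
    -(n : ℤ) ≤ y i ∧ y i < m := by
  have := Finset.mem_Ioc.1 (hy i)
  have := h1 i.castSucc
  have := h2 i.succ
  omega

theorem IsTilingWeight.eq_zero (ha : StrictMono a) (h1 : ∀ i, -(n + 1 : ℤ) ≤ a i)
    (h2 : ∀ i, a i < m) {y : Fin n → ℤ} (hy : ∀ i, y i ∈ Finset.Ioc (a i.castSucc) (a i.succ))
    (hf : IsTilingWeight (dentedTrap m y) f) (k : Fin 3) (x : ℤ) : f k (x, n) = 0 := by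
  have hb := interlacing_bounds h1 h2 hy
  have h := (isTilingWeight_dentedTrap (strictMono_of_interlacing ha hy) (fun i => (hb i).1)
    fun i => (hb i).2).1 hf x n
  rw [if_neg (by omega)] at h
  have := h.1
  fin_cases k <;> dsimp <;> omega

theorem isTilingWeight_stack (ha : StrictMono a) (h1 : ∀ i, -(n + 1 : ℤ) ≤ a i)
    (h2 : ∀ i, a i < m) {y : Fin n → ℤ} (hy : ∀ i, y i ∈ Finset.Ioc (a i.castSucc) (a i.succ))
    (hf : IsTilingWeight (dentedTrap m y) f) {r l : ℤ → ℕ}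
    (hr : IsRowTiling (-(n + 1 : ℤ)) (m - 1) a r l (occ y)) :
    IsTilingWeight (dentedTrap m a) (stack n f r l (occ y)) := by
  have hb := interlacing_bounds h1 h2 hy
  rw [isTilingWeight_dentedTrap (strictMono_of_interlacing ha hy) (fun i => (hb i).1)
    fun i => (hb i).2] at hf
  rw [isTilingWeight_dentedTrap ha (by simpa using h1) h2]
  push_cast
  intro x t
  have h := hf x t
  have h' := (hf x (n + 1)).1
  have h'' := hr x
  obtain rfl | ht := eq_or_ne t n
  · simp only [stack_zero, stack_one, stack_two, stack_of_ne (show (n : ℤ) + 1 ≠ n by omega)]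
    grind
  · obtain rfl | ht' := eq_or_ne t (n - 1)
    · simp only [sub_add_cancel, stack_two, stack_of_ne ht]
      grind
    · simp only [stack_of_ne ht, stack_of_ne (show t + 1 ≠ n by omega)]
      grind

theorem isTilingWeight_unstack (ha : StrictMono a) (h1 : ∀ i, -(n + 1 : ℤ) ≤ a i)
    (h2 : ∀ i, a i < m) {y : Fin n → ℤ} (hy : ∀ i, y i ∈ Finset.Ioc (a i.castSucc) (a i.succ))
    (hf : IsTilingWeight (dentedTrap m a) f) (hfy : (fun x => f 2 (x, n)) = occ y) :
    IsTilingWeight (dentedTrap m y) (stack n f 0 0 0) := by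
  have hb := interlacing_bounds h1 h2 hy
  rw [isTilingWeight_dentedTrap ha (by simpa using h1) h2] at hf
  rw [isTilingWeight_dentedTrap (strictMono_of_interlacing ha hy) (fun i => (hb i).1)
    fun i => (hb i).2]
  push_cast at hf
  intro x t
  have h := hf x t
  have h' := (hf x (n + 1)).1
  have h'' : f 2 (x, n) = occ y x := congrFun hfy x
  obtain rfl | ht := eq_or_ne t n
  · simp only [stack_zero, stack_one, stack_two, stack_of_ne (show (n : ℤ) + 1 ≠ n by omega),
      Pi.zero_apply]
    grind
  · obtain rfl | ht' := eq_or_ne t (n - 1)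
    · simp only [sub_add_cancel, stack_two, stack_of_ne ht, Pi.zero_apply] at h ⊢
      grind
    · simp only [stack_of_ne ht, stack_of_ne (show t + 1 ≠ n by omega)]
      grind

theorem exists_bijective_dentedTrapTiling (ha : StrictMono a) (h1 : ∀ i, -(n + 1 : ℤ) ≤ a i)
    (h2 : ∀ i, a i < m) :
    ∃ e : (Σ y : Fintype.piFinset fun i : Fin n => Finset.Ioc (a i.castSucc) (a i.succ),
      DentedTrapTiling m y.1) → DentedTrapTiling m a, Function.Bijective e := by
  have hy (y : Fintype.piFinset fun i : Fin n => Finset.Ioc (a i.castSucc) (a i.succ)) :=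
    Fintype.mem_piFinset.1 y.2
  choose r l hrl using fun y => exists_isRowTiling ha h1 (fun i => Int.le_sub_one_of_lt (h2 i))
    (hy y)
  refine ⟨fun f => ⟨_, isTilingWeight_stack ha h1 h2 (hy f.1) f.2.2 (hrl f.1)⟩, ?_, ?_⟩
  · rintro ⟨y, f, hf⟩ ⟨z, g, hg⟩ h
    simp only [Subtype.mk.injEq] at h
    have hyz : y.1 = z.1 := by
      refine eq_of_occ_eq (strictMono_of_interlacing ha (hy y))
        (strictMono_of_interlacing ha (hy z)) (funext fun x => ?_)
      simpa [stack_two] using congrFun (congrFun h 2) (x, (n : ℤ))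
    obtain rfl : y = z := Subtype.ext hyz
    obtain rfl : f = g := by
      funext k p
      obtain ⟨x, t⟩ := p
      obtain rfl | ht := eq_or_ne t n
      · rw [hf.eq_zero ha h1 h2 (hy y), hg.eq_zero ha h1 h2 (hy y)]
      · simpa [stack_of_ne ht] using congrFun (congrFun h k) (x, t)
    rfl
  · rintro ⟨f, hf⟩
    have hrow := hf.isRowTiling ha h1 h2
    obtain ⟨y, hyi, hvy⟩ := hrow.exists_interlacing ha h1 fun i => Int.le_sub_one_of_lt (h2 i)
    refine ⟨⟨⟨y, Fintype.mem_piFinset.2 hyi⟩, _, isTilingWeight_unstack ha h1 h2 hyi hf hvy⟩, ?_⟩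
    rw [hvy] at hrow
    obtain ⟨hr, hl⟩ := hrow.ext (hrl ⟨y, Fintype.mem_piFinset.2 hyi⟩)
    refine Subtype.ext (funext fun k => funext fun p => ?_)
    obtain ⟨x, t⟩ := p
    obtain rfl | ht := eq_or_ne t n
    · fin_cases k
      · simpa [stack_zero] using (congrFun hr x).symm
      · simpa [stack_one] using (congrFun hl x).symm
      · simpa [stack_two] using (congrFun hvy x).symm
    · simp [stack_of_ne ht]

end Recursion

section Determinant

/-- The determinant of the binomial coefficients `a i` choose `j`. -/
def binomialDet {n : ℕ} (a : Fin n → ℤ) : ℤ :=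
  (Matrix.of fun i j : Fin n => Ring.choose (a i) (j : ℕ)).det

theorem det_vandermonde_eq_mul_binomialDet {n : ℕ} (a : Fin n → ℤ) :
    (Matrix.vandermonde a).det = (∏ j : Fin n, ((j : ℕ).factorial : ℤ)) * binomialDet a := by
  rw [binomialDet, ← Matrix.det_mul_row,
    Matrix.det_eval_matrixOfPolynomials_eq_det_vandermonde a
      (fun j => descPochhammer ℤ j) (fun j => descPochhammer_natDegree ℤ j)
      (fun j => monic_descPochhammer ℤ j)]
  congr 1
  ext i j
  have := Ring.descPochhammer_eq_factorial_smul_choose (a i) j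
  rw [← Polynomial.eval_eq_smeval] at this
  simpa using this

theorem prod_factorial_ne_zero (n : ℕ) : ∏ j : Fin n, ((j : ℕ).factorial : ℤ) ≠ 0 :=
  Finset.prod_ne_zero_iff.2 fun j _ => by exact_mod_cast (j : ℕ).factorial_ne_zero

theorem binomialDet_add {n : ℕ} (a : Fin n → ℤ) (c : ℤ) :
    binomialDet (fun i => a i + c) = binomialDet a := by
  have h := Matrix.det_vandermonde_add a c
  rw [det_vandermonde_eq_mul_binomialDet, det_vandermonde_eq_mul_binomialDet] at h
  exact mul_left_cancel₀ (prod_factorial_ne_zero n) h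

theorem binomialDet_val (n : ℕ) : binomialDet (fun i : Fin n => (i : ℤ)) = 1 := by
  rw [binomialDet, Matrix.det_of_isLowerTriangular]
  · simp [Ring.choose_natCast]
  · intro i j hij
    simp only [OrderDual.toDual_lt_toDual] at hij
    simp [Ring.choose_natCast, Nat.choose_eq_zero_of_lt (Fin.lt_def.1 hij)]

theorem prod_div_eq_binomialDet {n : ℕ} (a : Fin n → ℤ) :
    ∏ p ∈ Finset.univ.filter (fun p : Fin n × Fin n => p.1 < p.2),
      (((a p.2 : ℤ) : ℚ) - ((a p.1 : ℤ) : ℚ)) / (((p.2 : ℕ) : ℚ) - ((p.1 : ℕ) : ℚ)) =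
        binomialDet a := by
  have key (b : Fin n → ℤ) : ∏ p ∈ Finset.univ.filter (fun p : Fin n × Fin n => p.1 < p.2),
      (((b p.2 : ℤ) : ℚ) - ((b p.1 : ℤ) : ℚ)) =
        (∏ j : Fin n, ((j : ℕ).factorial : ℤ) : ℤ) * binomialDet b := by
    rw [← Int.cast_mul, ← det_vandermonde_eq_mul_binomialDet, Matrix.det_vandermonde,
      Finset.prod_finset_product _ Finset.univ (fun i => Finset.Ioi i) (by simp)]
    push_cast
    rfl
  have h0 : ((∏ j : Fin n, ((j : ℕ).factorial : ℤ) : ℤ) : ℚ) ≠ 0 := by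
    exact_mod_cast prod_factorial_ne_zero n
  have h1 := key fun i => (i : ℤ)
  simp only [Int.cast_natCast, binomialDet_val, Int.cast_one, mul_one] at h1
  rw [Finset.prod_div_distrib, key a, h1, mul_div_cancel_left₀ _ h0]

theorem sum_Ioc_choose {p q : ℤ} (hpq : p ≤ q) (k : ℕ) :
    ∑ x ∈ Finset.Ioc p q, Ring.choose x k =
      Ring.choose (q + 1) (k + 1) - Ring.choose (p + 1) (k + 1) := by
  induction q, hpq using Int.leInduction with
  | base => simp
  | succ q hpq ih =>
    rw [sum_Ioc_int_succ _ hpq, ih, Ring.choose_succ_succ (q + 1) k]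
    ring

theorem sum_binomialDet {n : ℕ} {a : Fin (n + 1) → ℤ} (ha : Monotone a) :
    ∑ y ∈ Fintype.piFinset (fun i : Fin n => Finset.Ioc (a i.castSucc) (a i.succ)),
      binomialDet y = binomialDet a := by
  let A : Matrix (Fin (n + 1)) (Fin (n + 1)) ℤ := Matrix.of fun i j => Ring.choose (a i + 1) (j : ℕ)
  let B : Matrix (Fin (n + 1)) (Fin (n + 1)) ℤ :=
    Matrix.of (Fin.cons (A 0) fun i => A i.succ - A i.castSucc)
  have hAB : A.det = B.det := by
    refine Matrix.det_eq_of_forall_row_eq_smul_add_pred (fun _ => 1) ?_ ?_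
    · intro j
      simp [B]
    · intro i j
      simp [B]
  have hB : B.det = ∑ y ∈ Fintype.piFinset
      (fun i : Fin n => Finset.Ioc (a i.castSucc) (a i.succ)), binomialDet y := by
    rw [Matrix.det_succ_column_zero, Fin.sum_univ_succ]
    have := (Matrix.detRowAlternating (R := ℤ) (n := Fin n)).toMultilinearMap.map_sum_finset
      (fun i x j => Ring.choose x (j : ℕ))
      (fun i : Fin n => Finset.Ioc (a i.castSucc) (a i.succ))
    refine Eq.trans ?_ this
    simp only [B, A]
    rw [Finset.sum_eq_zero]
    · simp
      congr 1
      ext i j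
      rw [Finset.sum_apply, sum_Ioc_choose (ha Fin.castSucc_lt_succ.le)]
      simp
    · intro i _
      simp
  rw [← hB, ← hAB, ← binomialDet_add a 1]
  rfl

end Determinant

theorem dentedTrapTiling_card (m n : ℕ) (a : Fin n → ℤ) (ha : StrictMono a)
    (h1 : ∀ i, -(n : ℤ) ≤ a i) (h2 : ∀ i, a i < m) :
    Finite (DentedTrapTiling m a) ∧ (Nat.card (DentedTrapTiling m a) : ℤ) = binomialDet a := by
  induction n with
  | zero =>
    have : Unique (DentedTrapTiling m a) :=
      { default := ⟨0, by
          rw [isTilingWeight_dentedTrap ha h1 h2]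
          intro x y
          constructor
          · rw [if_neg (by omega)]
            rfl
          · have : occ a x = 0 := occ_eq_zero finZeroElim
            simp [this]
            omega⟩
        uniq := by
          rintro ⟨f, hf⟩
          rw [isTilingWeight_dentedTrap ha h1 h2] at hf
          refine Subtype.ext (funext fun k => funext fun ⟨x, y⟩ => ?_)
          have := (hf x y).1
          rw [if_neg (by omega)] at this
          change f k (x, y) = 0
          fin_cases k <;> dsimp <;> omega }
    exact ⟨inferInstance, by simp [binomialDet]⟩
  | succ n ih =>
    push_cast at h1
    obtain ⟨e, he⟩ := exists_bijective_dentedTrapTiling ha h1 h2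
    have key (y : Fintype.piFinset fun i : Fin n => Finset.Ioc (a i.castSucc) (a i.succ)) :=
      have hy := Fintype.mem_piFinset.1 y.2
      ih y.1 (strictMono_of_interlacing ha hy) (fun i => (interlacing_bounds h1 h2 hy i).1)
        (fun i => (interlacing_bounds h1 h2 hy i).2)
    have hfin := fun y => (key y).1
    refine ⟨Finite.of_surjective e he.2, ?_⟩
    rw [← Nat.card_eq_of_bijective e he, Nat.card_sigma, ← sum_binomialDet ha.monotone, Nat.cast_sum]
    exact (Finset.sum_congr rfl fun y _ => (key y).2).trans (Finset.sum_coe_sort _ binomialDet)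

/-- Cohn–Larsen–Propp: the number of lozenge tilings of the trapezoid of side lengths
`m, n, m+n, n` (clockwise from bottom) with the down-pointing unit triangles in positions
`x 1 < x 2 < ⋯ < x n` (counted from left to right) removed from along its top side equals
`∏_{1 ≤ i < j ≤ n} (x j - x i)/(j - i)`.  The down-pointing unit triangle in position `p`
(for `1 ≤ p ≤ m+n`) along the top side is the triangle `(p - n - 1, n - 1, false)`. -/
theorem trapezoid_dents (m n : ℕ) (x : Fin n → ℤ) (hx : StrictMono x)
    (hx1 : ∀ i, 1 ≤ x i) (hx2 : ∀ i, x i ≤ (m : ℤ) + n) :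
    (M (Trap m n \ {t | ∃ i : Fin n, t = (x i - n - 1, (n : ℤ) - 1, false)}) : ℚ) =
      ∏ p ∈ Finset.univ.filter (fun p : Fin n × Fin n => p.1 < p.2),
        (((x p.2 : ℤ) : ℚ) - ((x p.1 : ℤ) : ℚ)) / (((p.2 : ℕ) : ℚ) - ((p.1 : ℕ) : ℚ)) := by
  have ha : StrictMono fun i => x i + (-(n : ℤ) - 1) := hx.add_const _
  have hM : M (Trap m n \ {t | ∃ i : Fin n, t = (x i - n - 1, (n : ℤ) - 1, false)}) =
      Nat.card (DentedTrapTiling m fun i => x i + (-(n : ℤ) - 1)) := by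
    rw [M_eq_card_isTilingWeight]
    simp only [add_sub, ← sub_eq_add_neg]
  have h := (dentedTrapTiling_card m n _ ha (fun i => by have := hx1 i; omega)
    (fun i => by have := hx2 i; omega)).2
  rw [prod_div_eq_binomialDet, hM, ← binomialDet_add x (-(n : ℤ) - 1), ← h, Int.cast_natCast]
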